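/- If vertices u, v, w form an asteroidal triple in a reflexive graph G, then u, v are an invertible pair of G (and likewise v, w and u, w are invertible pairs); consequently a reflexive graph containing an asteroidal triple is not a strong cocomparability graph. -/

import Mathlib

/-- The strong cocomparability (Slash-free) ordering condition. -/
def IsSCOrdering {V : Type*} (E : V → V → Prop) (lt : V → V → Prop) : Prop :=
  ∀ u v x y : V, lt u v → lt x y → ¬(¬ E u x ∧ E u y ∧ E v x ∧ ¬ E v y)

/-- A strong cocomparability graph. -/
def IsStrongCocompGraph {V : Type*} (E : V → V → Prop) : Prop :=
  ∃ lt : V → V → Prop, IsStrictTotalOrder V lt ∧ IsSCOrdering E lt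

/-- The forcing relation Λ on ordered pairs of vertices. -/
def Forces {V : Type*} (E : V → V → Prop) (p q : V × V) : Prop :=
  p = q ∨ (E p.1 q.1 ∧ E p.2 q.2 ∧ ¬ E p.1 q.2 ∧ ¬ E p.2 q.1)

/-- The implication relation ~ generated by Λ. -/
def SimPair {V : Type*} (E : V → V → Prop) : V × V → V × V → Prop :=
  Relation.ReflTransGen (Forces E)

/-- `a` and `b` are joined by a path containing no neighbour of `w`
(neighbourhood with respect to `E`, which contains all loops). -/
def JoinedAvoiding {V : Type*} (E : V → V → Prop) (a b w : V) : Prop :=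
  ∃ p : List V, p ≠ [] ∧ p.Nodup ∧ p.Chain' E ∧
    p.head? = some a ∧ p.getLast? = some b ∧ ∀ x ∈ p, ¬ E x w

/-- An asteroidal triple: three pairwise non-adjacent vertices, any two of
which are joined by a path avoiding all neighbours of the third. -/
def IsAsteroidalTriple {V : Type*} (E : V → V → Prop) (u v w : V) : Prop :=
  u ≠ v ∧ v ≠ w ∧ u ≠ w ∧ ¬ E u v ∧ ¬ E v w ∧ ¬ E u w ∧
  JoinedAvoiding E u v w ∧ JoinedAvoiding E v w u ∧ JoinedAvoiding E u w v

/-- Moving the first coordinate along a path that avoids the neighbours of the second. -/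
theorem JoinedAvoiding.simPair_left {V : Type*} {E : V → V → Prop} (hsymm : ∀ ⦃x y⦄, E x y → E y x)
    (hrefl : ∀ x, E x x) {a b w : V} (h : JoinedAvoiding E a b w) :
    SimPair E (a, w) (b, w) := by
  obtain ⟨p, -, -, hc, ha, hb, hw⟩ := h
  induction p generalizing a with
  | nil => simp at ha
  | cons x t ih =>
    obtain rfl : x = a := by simpa using ha
    cases t with
    | nil =>
      obtain rfl : x = b := by simpa using hb
      exact Relation.ReflTransGen.refl
    | cons y t =>
      obtain ⟨hxy, hc⟩ := List.isChain_cons_cons.mp hc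
      refine Relation.ReflTransGen.head
        (Or.inr ⟨hxy, hrefl w, hw x (by simp), fun h => hw y (by simp) (hsymm h)⟩)
        (ih hc rfl (by simpa using hb) fun z hz => hw z (List.mem_cons_of_mem _ hz))

theorem Forces.symm {V : Type*} {E : V → V → Prop} (hsymm : ∀ ⦃x y⦄, E x y → E y x) {p q : V × V}
    (h : Forces E p q) : Forces E q p := by
  rcases h with rfl | ⟨h₁, h₂, h₃, h₄⟩
  · exact Or.inl rfl
  · exact Or.inr ⟨hsymm h₁, hsymm h₂, fun h => h₄ (hsymm h), fun h => h₃ (hsymm h)⟩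

theorem Forces.swap {V : Type*} {E : V → V → Prop} {p q : V × V}
    (h : Forces E p q) : Forces E p.swap q.swap := by
  rcases h with rfl | ⟨h₁, h₂, h₃, h₄⟩
  · exact Or.inl rfl
  · exact Or.inr ⟨h₂, h₁, h₄, h₃⟩

theorem SimPair.symm {V : Type*} {E : V → V → Prop} (hsymm : ∀ ⦃x y⦄, E x y → E y x) {p q : V × V}
    (h : SimPair E p q) : SimPair E q p := by
  induction h with
  | refl => exact Relation.ReflTransGen.refl
  | tail _ h ih => exact Relation.ReflTransGen.head (h.symm hsymm) ih

theorem SimPair.swap {V : Type*} {E : V → V → Prop} {p q : V × V}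
    (h : SimPair E p q) : SimPair E p.swap q.swap :=
  Relation.ReflTransGen.lift Prod.swap (fun _ _ h => Forces.swap h) _ _ h

/-- Forced pairs are ordered the same way by every Slash-free linear order. -/
theorem IsSCOrdering.lt_of_simPair {V : Type*} {E lt : V → V → Prop}
    (hlt : IsStrictTotalOrder V lt) (hsc : IsSCOrdering E lt) {p q : V × V}
    (h : SimPair E p q) (hp : lt p.1 p.2) : lt q.1 q.2 := by
  induction h with
  | refl => exact hp
  | @tail q r _ hqr ih =>
    rcases hqr with rfl | ⟨h₁, h₂, h₃, h₄⟩
    · exact ih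
    · rcases trichotomous_of lt r.1 r.2 with h | h | h
      · exact h
      · exact absurd (h ▸ h₁) h₃
      · exact absurd ⟨h₃, h₁, h₂, h₄⟩ (hsc _ _ _ _ ih h)

/-- A graph with an invertible pair is not a strong cocomparability graph. -/
theorem not_isStrongCocompGraph_of_simPair {V : Type*} {E : V → V → Prop}
    (hsymm : ∀ ⦃x y⦄, E x y → E y x) {u v : V} (hne : u ≠ v) (h : SimPair E (u, v) (v, u)) :
    ¬ IsStrongCocompGraph E := by
  rintro ⟨lt, hlt, hsc⟩
  rcases trichotomous_of lt u v with huv | huv | huv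
  · exact asymm_of lt huv (hsc.lt_of_simPair hlt h huv)
  · exact hne huv
  · exact asymm_of lt huv (hsc.lt_of_simPair hlt (h.symm hsymm) huv)

/-- If `u, v, w` form an asteroidal triple of a reflexive graph `G`, then
`u, v` (and likewise `v, w` and `u, w`) are invertible pairs of `G`;
consequently `G` is not a strong cocomparability graph. -/
theorem stmt11 {V : Type*} [Fintype V] (E : V → V → Prop)
    (hsymm : Symmetric E) (hrefl : Reflexive E) (u v w : V)
    (hat : IsAsteroidalTriple E u v w) :
    (u ≠ v ∧ SimPair E (u, v) (v, u)) ∧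
    (v ≠ w ∧ SimPair E (v, w) (w, v)) ∧
    (u ≠ w ∧ SimPair E (u, w) (w, u)) ∧
    ¬ IsStrongCocompGraph E := by
  obtain ⟨huv, hvw, huw, -, -, -, puv, pvw, puw⟩ := hat
  have h₁ : SimPair E (u, w) (v, w) := puv.simPair_left hsymm hrefl
  have h₂ : SimPair E (v, u) (w, u) := pvw.simPair_left hsymm hrefl
  have h₃ : SimPair E (u, v) (w, v) := puw.simPair_left hsymm hrefl
  have uv : SimPair E (u, v) (v, u) :=
    h₂.swap.trans (h₁.trans (h₃.swap.symm hsymm))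
  have vw : SimPair E (v, w) (w, v) :=
    (h₁.symm hsymm).trans ((h₂.swap.symm hsymm).trans h₃)
  have uw : SimPair E (u, w) (w, u) :=
    h₁.trans ((h₃.swap.symm hsymm).trans h₂)
  exact ⟨⟨huv, uv⟩, ⟨hvw, vw⟩, ⟨huw, uw⟩, not_isStrongCocompGraph_of_simPair hsymm huv uv⟩
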